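/- For all natural numbers r ≥ 3 and j ≤ 2r − 1, there is no projective 2^r-divisible binary linear code of effective length 3 + j·2^r (of any dimension k ≥ 1). -/

import Mathlib

/-- Hamming weight of a binary vector. -/
def hwt {n : ℕ} (c : Fin n → ZMod 2) : ℕ :=
  (Finset.univ.filter fun i => c i ≠ 0).card

/-- sign character -/
def sg (x : ZMod 2) : ℤ := if x = 0 then 1 else -1

lemma sg_add (x y : ZMod 2) : sg (x + y) = sg x * sg y := by
  revert x y; decide

lemma sg_char {V : Type*} [AddCommGroup V] [Fintype V] (f : V →+ ZMod 2) (d : V)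
    (hd : f d ≠ 0) : ∑ c, sg (f c) = 0 := by
  have h1 : ∑ c, sg (f (c + d)) = ∑ c, sg (f c) :=
    Equiv.sum_comp (Equiv.addRight d) (fun c => sg (f c))
  have h2 : sg (f d) = -1 := by simp [sg, hd]
  simp only [map_add, sg_add, h2] at h1
  rw [← Finset.sum_mul] at h1
  linarith

/-- the set of coordinates `S` is projective and `D`-divisible -/
def Good {V ι : Type*} [AddCommGroup V] (e : ι → V →+ ZMod 2) (D : ℕ) (S : Finset ι) : Prop :=
  (∀ i ∈ S, ∃ c, e i c ≠ 0) ∧ (∀ i ∈ S, ∀ j ∈ S, i ≠ j → ∃ c, e i c ≠ e j c) ∧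
  (∀ c, D ∣ (S.filter fun i => e i c ≠ 0).card)

section
variable {V ι : Type*} [AddCommGroup V] [Fintype V] (e : ι → V →+ ZMod 2)

/-- character sum -/
def uu (S : Finset ι) (c : V) : ℤ := ∑ i ∈ S, sg (e i c)

lemma uu_eq (S : Finset ι) (c : V) :
    uu e S c = S.card - 2 * (S.filter fun i => e i c ≠ 0).card := by
  unfold uu
  have : ∀ i, sg (e i c) = 1 - 2 * (if e i c ≠ 0 then 1 else 0) := by
    intro i; unfold sg; by_cases h : e i c = 0 <;> simp [h]
  simp only [this, Finset.sum_sub_distrib, ← Finset.mul_sum, Finset.card_filter]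
  push_cast
  simp

lemma sum_uu {D : ℕ} {S : Finset ι} (h : Good e D S) : ∑ c, uu e S c = 0 := by
  unfold uu
  rw [Finset.sum_comm]
  apply Finset.sum_eq_zero
  intro i hi
  obtain ⟨d, hd⟩ := h.1 i hi
  exact sg_char _ d hd

lemma sum_uu_sq {D : ℕ} {S : Finset ι} (h : Good e D S) :
    ∑ c, (uu e S c) ^ 2 = Fintype.card V * S.card := by
  unfold uu
  simp only [sq, Finset.sum_mul_sum]
  rw [Finset.sum_comm]
  have : ∀ i ∈ S, ∑ c, ∑ j ∈ S, sg (e i c) * sg (e j c) = Fintype.card V := by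
    intro i hi
    rw [Finset.sum_comm, Finset.sum_eq_single_of_mem i hi]
    · have : ∀ x : ZMod 2, sg x * sg x = 1 := by decide
      simp [this]
    · intro j hj hij
      obtain ⟨d, hd⟩ := h.2.1 j hj i hi hij
      have := sg_char (e i + e j) d (by
        have : ∀ x y : ZMod 2, x ≠ y → y + x ≠ 0 := by decide
        exact this _ _ hd)
      simpa [sg_add] using this
  rw [Finset.sum_congr rfl this]
  simp [mul_comm]

lemma moment {D : ℕ} {S : Finset ι} (h : Good e D S) (a b : ℤ)
    (hu : ∀ c, b ≤ (uu e S c - a) ^ 2) : b ≤ S.card + a ^ 2 := by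
  have h1 : ∑ c : V, b ≤ ∑ c, (uu e S c - a) ^ 2 := Finset.sum_le_sum fun c _ => hu c
  have h2 : ∑ c, (uu e S c - a) ^ 2 = Fintype.card V * (S.card + a ^ 2) := by
    have : ∀ c, (uu e S c - a) ^ 2 = uu e S c ^ 2 - 2 * a * uu e S c + a ^ 2 := by
      intro c; ring
    simp only [this, Finset.sum_add_distrib, Finset.sum_sub_distrib, ← Finset.mul_sum,
      sum_uu e h, sum_uu_sq e h]
    simp
    ring
  rw [h2] at h1
  simp only [Finset.sum_const, Finset.card_univ, nsmul_eq_mul] at h1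
  have : (0 : ℤ) < Fintype.card V := by exact_mod_cast Fintype.card_pos
  exact le_of_mul_le_mul_left h1 this

lemma not_pos {D : ℕ} {S : Finset ι} (h : Good e D S) (hu : ∀ c, 0 < uu e S c) : False := by
  have := Finset.sum_pos (fun c (_ : c ∈ Finset.univ) => hu c) (Finset.univ_nonempty (α := V))
  rw [sum_uu e h] at this
  exact lt_irrefl _ this

lemma good_residual {D : ℕ} {S : Finset ι} (h : Good e (2 * D) S) (c : V) :
    Good e D (S.filter fun i => ¬ (e i c ≠ 0)) := by
  refine ⟨fun i hi => h.1 i (Finset.mem_filter.1 hi).1, fun i hi j hj =>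
    h.2.1 i (Finset.mem_filter.1 hi).1 j (Finset.mem_filter.1 hj).1, fun d => ?_⟩
  have key : (S.filter fun i => e i d ≠ 0).card + (S.filter fun i => e i (c + d) ≠ 0).card
      = (S.filter fun i => e i c ≠ 0).card
        + 2 * ((S.filter fun i => ¬ (e i c ≠ 0)).filter fun i => e i d ≠ 0).card := by
    simp only [Finset.filter_filter, Finset.card_filter]
    rw [Finset.mul_sum, ← Finset.sum_add_distrib, ← Finset.sum_add_distrib]
    apply Finset.sum_congr rfl
    intro i _
    rw [map_add]
    generalize e i c = x
    generalize e i d = y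
    revert x y; decide
  have h3 := (Nat.dvd_add_right (h.2.2 c)).1 (key ▸ Dvd.dvd.add (h.2.2 d) (h.2.2 (c + d)))
  exact Nat.dvd_of_mul_dvd_mul_left (by norm_num) h3

lemma weights {D j : ℕ} (hD : 3 < D) {S : Finset ι} (h : Good e D S) (hS : S.card = 3 + j * D)
    (c : V) : ∃ t, t ≤ j ∧ (S.filter fun i => ¬ (e i c ≠ 0)).card = 3 + t * D ∧
      uu e S c = 3 + (2 * t - j) * D := by
  obtain ⟨a, ha⟩ := h.2.2 c
  have hs := Finset.card_filter_add_card_filter_not (s := S) (fun i => e i c ≠ 0)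
  have haj : a ≤ j := by
    by_contra hlt
    have : D * (j + 1) ≤ D * a := Nat.mul_le_mul_left _ (by omega)
    nlinarith
  obtain ⟨t, rfl⟩ := Nat.exists_eq_add_of_le haj
  refine ⟨t, by omega, ?_, ?_⟩
  · rw [ha, hS] at hs
    nlinarith
  · rw [uu_eq, ha, hS]
    push_cast
    ring

lemma odd_case {D j : ℕ} (hD : 3 < D) {S : Finset ι} (h : Good e D S)
    (hS : S.card = 3 + j * D) (hj : Odd j) (hb : j * D + 12 < D * D) : False := by
  have := moment e h 3 (D ^ 2) (fun c => by
    obtain ⟨t, _, _, hu⟩ := weights e hD h hS c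
    rw [hu]
    obtain ⟨m, rfl⟩ := hj
    have : (1 : ℤ) ≤ (2 * t - (2 * m + 1)) ^ 2 := by
      have : (2 * (t : ℤ) - (2 * m + 1)) ≠ 0 := by omega
      have := sq_pos_of_ne_zero this
      omega
    push_cast
    nlinarith [sq_nonneg (D : ℤ)])
  rw [hS] at this
  push_cast at this
  zify at hb
  nlinarith

lemma even_case {r : ℕ} (hr : 2 ≤ r) : ∀ t ≤ r - 1, ∀ S : Finset ι, Good e (2 ^ r) S →
    S.card = 3 + (2 * t) * 2 ^ r → False := by
  induction r, hr using Nat.le_induction with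
  | base =>
    intro t ht S h hS
    have := moment e h (-1) 16 (fun c => by
      obtain ⟨s, _, _, hu⟩ := weights e (by norm_num) h hS c
      rw [hu]
      push_cast
      have : (1 : ℤ) ≤ (1 + 2 * (s - t)) ^ 2 := by
        have : (1 + 2 * ((s : ℤ) - t)) ≠ 0 := by omega
        have := sq_pos_of_ne_zero this
        omega
      nlinarith)
    rw [hS] at this
    push_cast at this
    omega
  | succ r hr ih =>
    intro t ht S h hS
    have hD : 3 < 2 ^ (r + 1) := by
      have := Nat.pow_le_pow_right (n := 2) (by norm_num) (show 2 ≤ r + 1 by omega)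
      omega
    apply not_pos e h
    intro c
    obtain ⟨s, _, hs, hu⟩ := weights e hD h hS c
    by_cases hsr : s ≤ r - 1
    · exfalso
      refine ih s hsr _ (good_residual e (by rwa [pow_succ'] at h) c) ?_
      rw [hs]; ring
    · rw [hu]
      have : (0 : ℤ) ≤ 2 * s - (2 * t : ℕ) := by push_cast; omega
      positivity

end

lemma two_pow_aux (r : ℕ) (hr : 3 ≤ r) : 2 * r + 2 ≤ 2 ^ r := by
  induction r, hr using Nat.le_induction with
  | base => norm_num
  | succ r hr ih => rw [pow_succ]; omega

/-- For `r ≥ 3` and `j ≤ 2r − 1`, no projective `2^r`-divisible binary linear code of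
effective length `3 + j·2^r` (of any dimension `k ≥ 1`) exists. -/
theorem no_projective_divisible_aux (r j : ℕ) (hr : 3 ≤ r) (hj : j ≤ 2 * r - 1) :
    ¬ ∃ C : Submodule (ZMod 2) (Fin (3 + j * 2 ^ r) → ZMod 2),
      1 ≤ Module.finrank (ZMod 2) C ∧
      (∀ i, ∃ c ∈ C, c i ≠ 0) ∧
      (∀ i j', i ≠ j' → ∃ c ∈ C, c i ≠ c j') ∧
      (∀ c ∈ C, 2 ^ r ∣ hwt c) := by
  rintro ⟨C, -, h1, h2, h3⟩
  classical
  have : Fintype C := Fintype.ofFinite C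
  let e : Fin (3 + j * 2 ^ r) → C →+ ZMod 2 := fun i =>
    (Pi.evalAddMonoidHom (fun _ => ZMod 2) i).comp C.subtype.toAddMonoidHom
  have he : ∀ i c, e i c = c.1 i := fun i c => rfl
  have hg : Good e (2 ^ r) Finset.univ := by
    refine ⟨fun i _ => ?_, fun i _ k _ hik => ?_, fun c => h3 c.1 c.2⟩
    · obtain ⟨c, hc, h⟩ := h1 i
      exact ⟨⟨c, hc⟩, h⟩
    · obtain ⟨c, hc, h⟩ := h2 i k hik
      exact ⟨⟨c, hc⟩, h⟩
  have hc : (Finset.univ : Finset (Fin (3 + j * 2 ^ r))).card = 3 + j * 2 ^ r := by simp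
  have h8 : 8 ≤ 2 ^ r := Nat.pow_le_pow_right (n := 2) (by norm_num) hr
  have hp := two_pow_aux r hr
  rcases Nat.even_or_odd' j with ⟨t, ht | ht⟩
  · exact even_case e (by omega) t (by omega) _ hg (by rw [hc, ← ht])
  · refine odd_case e (by omega) hg hc ⟨t, ht⟩ ?_
    have : (j + 2) * 2 ^ r ≤ 2 ^ r * 2 ^ r := Nat.mul_le_mul_right _ (by omega)
    nlinarith
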